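/- arXiv:gr-qc/9906087 — 2 statements merged into one kernel-verified Lean document; each statement's English description precedes it below -/
import Mathlib

section
/- Let 1 ≤ p ≤ n. If Σ is a nonzero p-form on n-dimensional Minkowski space and u, w are future-pointing timelike vectors, then T{Σ}_{λμ} u^λ w^μ > 0 (strict positivity of the super-energy tensor on timelike vectors). -/
open Finset

noncomputable section

/-- Components of the Minkowski metric (and of its inverse) in dimension `n`. -/
def gmet (n : ℕ) (μ ν : Fin n) : ℝ :=
  if μ = ν then (if (μ : ℕ) = 0 then -1 else 1) else 0

/-- Minkowski square `η_{μν} v^μ v^ν` of a vector. -/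
def minkSq (n : ℕ) (v : Fin n → ℝ) : ℝ :=
  ∑ μ : Fin n, ∑ ν : Fin n, gmet n μ ν * v μ * v ν

/-- A `p`-form: a totally antisymmetric `p`-index covariant tensor. -/
def IsPForm (n p : ℕ) (S : (Fin p → Fin n) → ℝ) : Prop :=
  ∀ (σ : Equiv.Perm (Fin p)) (μ : Fin p → Fin n),
    S (μ ∘ σ) = ((Equiv.Perm.sign σ : ℤ) : ℝ) * S μ

/-- The contraction `Σ_{λρ₂…ρ_p} Σ_μ{}^{ρ₂…ρ_p}`. -/
def partContract (n p : ℕ) (hp : 0 < p) (S : (Fin p → Fin n) → ℝ) (lam mu : Fin n) : ℝ :=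
  ∑ ρ : Fin p → Fin n, ∑ τ : Fin p → Fin n,
    if ρ ⟨0, hp⟩ = lam ∧ τ ⟨0, hp⟩ = mu then
      S ρ * S τ *
        ∏ i ∈ Finset.univ.filter (fun i => i ≠ (⟨0, hp⟩ : Fin p)), gmet n (ρ i) (τ i)
    else 0

/-- The full contraction `Σ_{ρ₁…ρ_p} Σ^{ρ₁…ρ_p}`. -/
def fullContract (n p : ℕ) (S : (Fin p → Fin n) → ℝ) : ℝ :=
  ∑ ρ : Fin p → Fin n, ∑ τ : Fin p → Fin n,
    S ρ * S τ * ∏ i : Fin p, gmet n (ρ i) (τ i)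

/-- The basic super-energy tensor `T{Σ}_{λμ}` of a `p`-form. -/
def seT (n p : ℕ) (hp : 0 < p) (S : (Fin p → Fin n) → ℝ) (lam mu : Fin n) : ℝ :=
  (1 / ((p - 1).factorial : ℝ)) * partContract n p hp S lam mu
    - (1 / (2 * (p.factorial : ℝ))) * gmet n lam mu * fullContract n p S

/-- Kronecker product of a family of matrices, indexed by multi-indices. -/
def kron {n p : ℕ} (M : Fin p → Matrix (Fin n) (Fin n) ℝ) :
    Matrix (Fin p → Fin n) (Fin p → Fin n) ℝ :=
  fun ρ τ => ∏ i, M i (ρ i) (τ i)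

lemma kron_mul {n p : ℕ} (M N : Fin p → Matrix (Fin n) (Fin n) ℝ) :
    kron M * kron N = kron (fun i => M i * N i) := by
  ext ρ τ
  simp only [kron, Matrix.mul_apply, ← Finset.prod_mul_distrib]
  rw [Finset.prod_univ_sum]
  simp

lemma kron_transpose {n p : ℕ} (M : Fin p → Matrix (Fin n) (Fin n) ℝ) :
    (kron M).transpose = kron (fun i => (M i).transpose) := by
  ext ρ τ
  simp [kron, Matrix.transpose_apply]

lemma kron_one {n p : ℕ} :
    kron (fun _ : Fin p => (1 : Matrix (Fin n) (Fin n) ℝ)) = 1 := by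
  ext ρ τ
  simp only [kron, Matrix.one_apply]
  by_cases h : ρ = τ
  · simp [h]
  · rw [if_neg h]
    obtain ⟨i, hi⟩ := Function.ne_iff.mp h
    exact Finset.prod_eq_zero (Finset.mem_univ i) (if_neg hi)

/-- Quadratic form attached to a family of matrices. -/
def kq {n p : ℕ} (M : Fin p → Matrix (Fin n) (Fin n) ℝ) (S : (Fin p → Fin n) → ℝ) : ℝ :=
  S ⬝ᵥ (kron M).mulVec S

lemma kq_kron {n p : ℕ} (M : Fin p → Matrix (Fin n) (Fin n) ℝ) (A : Matrix (Fin n) (Fin n) ℝ)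
    (S : (Fin p → Fin n) → ℝ) :
    kq M ((kron (fun _ => A)).mulVec S) = kq (fun i => A.transpose * M i * A) S := by
  unfold kq
  rw [← kron_mul (fun i => A.transpose * M i) (fun _ => A), ← kron_mul (fun i => A.transpose) M,
    ← kron_transpose, ← Matrix.mulVec_mulVec, ← Matrix.mulVec_mulVec, Matrix.dotProduct_mulVec S,
    Matrix.vecMul_transpose]

lemma kq_eq {n p : ℕ} (M : Fin p → Matrix (Fin n) (Fin n) ℝ) (S : (Fin p → Fin n) → ℝ) :
    kq M S = ∑ ρ, ∑ τ, S ρ * S τ * ∏ i, M i (ρ i) (τ i) := by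
  simp only [kq, kron, dotProduct, Matrix.mulVec, Finset.mul_sum]
  refine Finset.sum_congr rfl fun ρ _ => Finset.sum_congr rfl fun τ _ => by ring

/-- the metric as a matrix -/
def gM (n : ℕ) : Matrix (Fin n) (Fin n) ℝ := Matrix.of (gmet n)

def Mpart {n p : ℕ} (hp : 0 < p) (u w : Fin n → ℝ) (i : Fin p) : Matrix (Fin n) (Fin n) ℝ :=
  if i = ⟨0, hp⟩ then Matrix.vecMulVec u w else gM n

/-- the contracted super-energy tensor -/
def TT {n p : ℕ} (hp : 0 < p) (S : (Fin p → Fin n) → ℝ) (u w : Fin n → ℝ) : ℝ :=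
  (1 / ((p - 1).factorial : ℝ)) * kq (Mpart hp u w) S
    - (1 / (2 * (p.factorial : ℝ))) * (u ⬝ᵥ (gM n).mulVec w) * kq (fun _ => gM n) S

lemma part_eq {n p : ℕ} (hp : 0 < p) (S : (Fin p → Fin n) → ℝ) (u w : Fin n → ℝ) :
    ∑ lam, ∑ mu, partContract n p hp S lam mu * u lam * w mu = kq (Mpart hp u w) S := by
  rw [kq_eq]
  simp only [partContract, Finset.sum_mul]
  have h1 : ∀ (f : Fin n → Fin n → (Fin p → Fin n) → (Fin p → Fin n) → ℝ),
      ∑ l, ∑ m, ∑ ρ, ∑ τ, f l m ρ τ = ∑ ρ, ∑ τ, ∑ l, ∑ m, f l m ρ τ := by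
    intro f
    calc _ = ∑ l, ∑ ρ, ∑ m, ∑ τ, f l m ρ τ :=
          Finset.sum_congr rfl fun l _ => Finset.sum_comm
      _ = ∑ ρ, ∑ l, ∑ m, ∑ τ, f l m ρ τ := Finset.sum_comm
      _ = ∑ ρ, ∑ l, ∑ τ, ∑ m, f l m ρ τ :=
          Finset.sum_congr rfl fun ρ _ => Finset.sum_congr rfl fun l _ => Finset.sum_comm
      _ = _ := Finset.sum_congr rfl fun ρ _ => Finset.sum_comm
  rw [h1]
  refine Finset.sum_congr rfl fun ρ _ => Finset.sum_congr rfl fun τ _ => ?_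
  rw [Finset.sum_eq_single (ρ ⟨0, hp⟩), Finset.sum_eq_single (τ ⟨0, hp⟩)]
  · rw [if_pos ⟨rfl, rfl⟩, ← Finset.mul_prod_erase _ _ (Finset.mem_univ (⟨0, hp⟩ : Fin p))]
    have : ∏ x ∈ Finset.univ.erase (⟨0, hp⟩ : Fin p), Mpart hp u w x (ρ x) (τ x)
        = ∏ i ∈ Finset.univ.filter (fun i => i ≠ (⟨0, hp⟩ : Fin p)), gmet n (ρ i) (τ i) := by
      refine Finset.prod_congr (by ext; simp) fun i hi => ?_
      have : i ≠ ⟨0, hp⟩ := by simpa using hi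
      simp [Mpart, this, gM]
    rw [this]
    simp [Mpart, Matrix.vecMulVec_apply]
    ring
  · intro b _ hb
    rw [if_neg (fun h => hb h.2.symm)]; ring
  · simp
  · intro b _ hb
    refine Finset.sum_eq_zero fun m _ => ?_
    rw [if_neg (fun h => hb h.1.symm)]; ring
  · simp

lemma seT_eq {n p : ℕ} (hp : 0 < p) (S : (Fin p → Fin n) → ℝ) (u w : Fin n → ℝ) :
    ∑ lam, ∑ mu, seT n p hp S lam mu * u lam * w mu = TT hp S u w := by
  unfold TT
  have hf : kq (fun _ => gM n) S = fullContract n p S := by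
    rw [kq_eq]; rfl
  rw [← part_eq, hf]
  simp only [seT, dotProduct, Matrix.mulVec, Finset.mul_sum, sub_mul, Finset.sum_sub_distrib]
  congr 1
  · refine Finset.sum_congr rfl fun ρ _ => Finset.sum_congr rfl fun τ _ => by ring
  · rw [Finset.sum_mul]
    refine Finset.sum_congr rfl fun ρ _ => ?_
    rw [Finset.sum_mul]
    refine Finset.sum_congr rfl fun τ _ => ?_
    have : gM n ρ τ = gmet n ρ τ := rfl
    rw [this]
    ring

lemma kron_pform {n p : ℕ} (A : Matrix (Fin n) (Fin n) ℝ) (S : (Fin p → Fin n) → ℝ)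
    (hS : IsPForm n p S) : IsPForm n p ((kron (fun _ => A)).mulVec S) := by
  intro σ μ
  simp only [Matrix.mulVec, dotProduct, kron, Finset.mul_sum]
  rw [← Equiv.sum_comp (Equiv.arrowCongr σ.symm (Equiv.refl (Fin n)))]
  refine Finset.sum_congr rfl fun τ _ => ?_
  have h1 : (Equiv.arrowCongr σ.symm (Equiv.refl (Fin n))) τ = τ ∘ σ := by
    ext i; simp [Equiv.arrowCongr]
  rw [h1, hS]
  have : ∏ i, A ((μ ∘ σ) i) ((τ ∘ σ) i) = ∏ i, A (μ i) (τ i) :=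
    Equiv.prod_comp σ (fun i => A (μ i) (τ i))
  rw [this]; ring

/-- positivity for all forms at a pair of vectors -/
def Pos {n p : ℕ} (hp : 0 < p) (u w : Fin n → ℝ) : Prop :=
  ∀ S : (Fin p → Fin n) → ℝ, IsPForm n p S → S ≠ 0 → 0 < TT hp S u w

lemma Pos_of {n p : ℕ} (hp : 0 < p) (u w : Fin n → ℝ) (R : Matrix (Fin n) (Fin n) ℝ)
    (h1 : R * R = 1) (h2 : R * gM n * R.transpose = gM n) (h3 : R.transpose * gM n * R = gM n)
    (h : Pos (p := p) hp (R.mulVec u) (R.mulVec w)) : Pos (p := p) hp u w := by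
  intro S hS hS0
  have h1' : R.transpose * R.transpose = 1 := by
    rw [← Matrix.transpose_mul, h1, Matrix.transpose_one]
  have key := h _ (kron_pform R.transpose S hS) (by
    intro h0
    apply hS0
    have : (kron (fun _ => R.transpose)).mulVec ((kron (fun _ : Fin p => R.transpose)).mulVec S)
        = S := by
      rw [Matrix.mulVec_mulVec, kron_mul, h1', kron_one, Matrix.one_mulVec]
    rw [← this, h0, Matrix.mulVec_zero])
  unfold TT at key ⊢
  rw [kq_kron, kq_kron, Matrix.transpose_transpose] at key
  have e1 : (fun i => R * Mpart (p := p) hp (R.mulVec u) (R.mulVec w) i * R.transpose)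
      = Mpart hp u w := by
    funext i
    unfold Mpart
    split_ifs
    · rw [Matrix.mul_vecMulVec, Matrix.vecMulVec_mul, Matrix.vecMul_transpose,
        Matrix.mulVec_mulVec, Matrix.mulVec_mulVec, h1, Matrix.one_mulVec, Matrix.one_mulVec]
    · exact h2
  have e2 : (R.mulVec u) ⬝ᵥ (gM n).mulVec (R.mulVec w) = u ⬝ᵥ (gM n).mulVec w := by
    conv_rhs => rw [← h3]
    rw [← Matrix.mulVec_mulVec, ← Matrix.mulVec_mulVec, Matrix.dotProduct_mulVec u,
      Matrix.vecMul_transpose]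
  rw [e1, e2] at key
  simpa only [h2] using key

lemma gM_mul (n : ℕ) : gM n * gM n = 1 := by
  ext i j
  simp only [Matrix.mul_apply, gM, gmet, Matrix.of_apply, Matrix.one_apply]
  simp
  split_ifs <;> simp_all

lemma gM_tr (n : ℕ) : (gM n).transpose = gM n := by
  ext i j
  simp only [Matrix.transpose_apply, gM, gmet, Matrix.of_apply]
  by_cases h : i = j
  · simp [h]
  · simp [h, Ne.symm h]

/-- Minkowski product -/
def mkp {n : ℕ} (u w : Fin n → ℝ) : ℝ := u ⬝ᵥ (gM n).mulVec w

lemma Pos_refl {n p : ℕ} (hp : 0 < p) (u w v : Fin n → ℝ) (hv : mkp v v ≠ 0)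
    (h : Pos (p := p) hp (u - (2 * mkp v u / mkp v v) • v) (w - (2 * mkp v w / mkp v v) • v)) :
    Pos (p := p) hp u w := by
  set y := (gM n).mulVec v with hy
  have hgy : (gM n).mulVec y = v := by rw [hy, Matrix.mulVec_mulVec, gM_mul, Matrix.one_mulVec]
  have hgv : Matrix.vecMul v (gM n) = y := by
    rw [hy, ← Matrix.vecMul_transpose, gM_tr]
  have hgy' : Matrix.vecMul y (gM n) = v := by
    rw [← Matrix.mulVec_transpose, gM_tr, hgy]
  have hvy : v ⬝ᵥ y = mkp v v := rfl
  have hyv : y ⬝ᵥ v = mkp v v := by rw [dotProduct_comm]; rfl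
  set c := 2 / mkp v v with hc
  set R : Matrix (Fin n) (Fin n) ℝ := 1 - c • Matrix.vecMulVec v y with hR
  have hRx : ∀ x, R.mulVec x = x - (2 * mkp v x / mkp v v) • v := by
    intro x
    have : mkp v x = y ⬝ᵥ x := by
      unfold mkp; rw [Matrix.dotProduct_mulVec, hgv]
    rw [hR, Matrix.sub_mulVec, Matrix.one_mulVec, Matrix.smul_mulVec, Matrix.vecMulVec_mulVec,
      this, hc]
    ext i
    simp
    ring
  have hRT : R.transpose = 1 - c • Matrix.vecMulVec y v := by
    rw [hR, Matrix.transpose_sub, Matrix.transpose_one, Matrix.transpose_smul,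
      Matrix.transpose_vecMulVec]
  have hRR : R * R = 1 := by
    have : Matrix.vecMulVec v y * Matrix.vecMulVec v y = mkp v v • Matrix.vecMulVec v y := by
      ext i j
      simp only [Matrix.mul_apply, Matrix.vecMulVec_apply, Matrix.smul_apply, smul_eq_mul,
        ← hyv, dotProduct, Finset.sum_mul]
      exact Finset.sum_congr rfl fun k _ => by ring
    rw [hR, sub_mul, one_mul, Matrix.smul_mul, Matrix.mul_sub, Matrix.mul_smul,
      this, Matrix.mul_one]
    ext i j
    simp only [Matrix.sub_apply, Matrix.smul_apply, smul_eq_mul, hc]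
    field_simp
    ring
  have hDR : gM n * R = R.transpose * gM n := by
    rw [hRT, hR, mul_sub, sub_mul, Matrix.mul_smul, Matrix.smul_mul, Matrix.mul_vecMulVec,
      Matrix.vecMulVec_mul, hgv, mul_one, one_mul]
  have hDRT : gM n * R.transpose = R * gM n := by
    rw [hRT, hR, mul_sub, sub_mul, Matrix.mul_smul, Matrix.smul_mul, Matrix.mul_vecMulVec,
      Matrix.vecMulVec_mul, hgy, hgy', mul_one, one_mul]
  refine Pos_of hp u w R hRR ?_ ?_ ?_
  · rw [mul_assoc, hDRT, ← mul_assoc, hRR, one_mul]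
  · rw [mul_assoc, hDR, ← mul_assoc, ← Matrix.transpose_mul, hRR, Matrix.transpose_one, one_mul]
  · rw [hRx, hRx]; exact h

lemma sum_slot {n p : ℕ} (F : (Fin p → Fin n) → ℝ)
    (hF : ∀ (σ : Equiv.Perm (Fin p)) (μ : Fin p → Fin n), F (μ ∘ σ) = F μ) (b : Fin n)
    (k k0 : Fin p) :
    ∑ ρ : Fin p → Fin n, (if ρ k = b then F ρ else 0)
      = ∑ ρ : Fin p → Fin n, (if ρ k0 = b then F ρ else 0) := by
  rw [← Equiv.sum_comp (Equiv.arrowCongr (Equiv.swap k k0) (Equiv.refl (Fin n)))]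
  refine Finset.sum_congr rfl fun τ _ => ?_
  have h1 : (Equiv.arrowCongr (Equiv.swap k k0) (Equiv.refl (Fin n))) τ
      = τ ∘ (Equiv.swap k k0) := by
    ext i; simp [Equiv.arrowCongr]
  rw [h1, hF]
  simp

/-- number of occurrences of an index -/
def cnt {n p : ℕ} (b : Fin n) (ρ : Fin p → Fin n) : ℝ := ∑ k, if ρ k = b then (1 : ℝ) else 0

lemma sum_cnt {n p : ℕ} (F : (Fin p → Fin n) → ℝ)
    (hF : ∀ (σ : Equiv.Perm (Fin p)) (μ : Fin p → Fin n), F (μ ∘ σ) = F μ) (b : Fin n)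
    (k0 : Fin p) :
    ∑ ρ, F ρ * cnt b ρ = p * ∑ ρ : Fin p → Fin n, (if ρ k0 = b then F ρ else 0) := by
  simp only [cnt, Finset.mul_sum, mul_ite, mul_one, mul_zero]
  rw [Finset.sum_comm]
  rw [Finset.sum_congr rfl fun k _ => sum_slot F hF b k k0]
  simp [Finset.mul_sum]

lemma pform_inj {n p : ℕ} {S : (Fin p → Fin n) → ℝ} (hS : IsPForm n p S) {ρ : Fin p → Fin n}
    (h : S ρ ≠ 0) : Function.Injective ρ := by
  intro i j hij
  by_contra hne
  apply h
  have h1 := hS (Equiv.swap i j) ρ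
  have h2 : ρ ∘ (Equiv.swap i j) = ρ := by
    funext k
    simp only [Function.comp_apply, Equiv.swap_apply_def]
    split_ifs with h1 h2
    · rw [h1, hij]
    · rw [h2, hij]
    · rfl
  rw [h2, Equiv.Perm.sign_swap hne] at h1
  push_cast at h1
  linarith

lemma cnt_of_mem {n p : ℕ} {ρ : Fin p → Fin n} (h : Function.Injective ρ) (k : Fin p) :
    cnt (ρ k) ρ = 1 := by
  unfold cnt
  rw [Finset.sum_eq_single k]
  · simp
  · intro j _ hj
    exact if_neg fun h' => hj (h h')
  · simp

lemma cnt_of_not_mem {n p : ℕ} {ρ : Fin p → Fin n} {b : Fin n} (h : ∀ k, ρ k ≠ b) :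
    cnt b ρ = 0 := by
  unfold cnt
  exact Finset.sum_eq_zero fun k _ => if_neg (h k)

lemma gmet_self {n : ℕ} {i z : Fin n} (hz : (z : ℕ) = 0) (h : i ≠ z) : gmet n i i = 1 := by
  have : (i : ℕ) ≠ 0 := fun h' => h (Fin.ext (by omega))
  simp [gmet, this]

lemma prod_erase_one {n p : ℕ} {z : Fin n} (hz : (z : ℕ) = 0) {ρ : Fin p → Fin n}
    (h : Function.Injective ρ) (k : Fin p) (hk : ρ k = z) :
    ∏ i ∈ Finset.univ.erase k, gmet n (ρ i) (ρ i) = 1 := by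
  refine Finset.prod_eq_one fun i hi => ?_
  refine gmet_self hz fun h' => ?_
  exact (Finset.ne_of_mem_erase hi) (h (h'.trans hk.symm))

lemma prod_cnt {n p : ℕ} {z : Fin n} (hz : (z : ℕ) = 0) {ρ : Fin p → Fin n}
    (h : Function.Injective ρ) :
    ∏ i, gmet n (ρ i) (ρ i) = 1 - 2 * cnt z ρ := by
  by_cases hk : ∃ k, ρ k = z
  · obtain ⟨k, hk⟩ := hk
    rw [← Finset.mul_prod_erase _ _ (Finset.mem_univ k), prod_erase_one hz h k hk, ← hk,
      cnt_of_mem h, hk]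
    simp [gmet, hz]
    norm_num
  · push Not at hk
    rw [cnt_of_not_mem hk, Finset.prod_eq_one fun i _ => gmet_self hz (hk i)]
    norm_num

lemma kq_gM {n p : ℕ} {z : Fin n} (hz : (z : ℕ) = 0) {S : (Fin p → Fin n) → ℝ}
    (hS : IsPForm n p S) :
    kq (fun _ => gM n) S = ∑ ρ, S ρ ^ 2 * (1 - 2 * cnt z ρ) := by
  rw [kq_eq]
  refine Finset.sum_congr rfl fun ρ _ => ?_
  rw [Finset.sum_eq_single ρ]
  · by_cases h : S ρ = 0
    · simp [h]
    · rw [← prod_cnt hz (pform_inj hS h)]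
      simp only [gM, Matrix.of_apply]
      ring
  · intro τ _ hτ
    obtain ⟨i, hi⟩ := Function.ne_iff.mp hτ
    rw [Finset.prod_eq_zero (Finset.mem_univ i), mul_zero]
    simp [gM, gmet, Ne.symm hi]
  · simp

lemma kq_part {n p : ℕ} (hp : 0 < p) {z : Fin n} (hz : (z : ℕ) = 0) (a : Fin n)
    {S : (Fin p → Fin n) → ℝ} (hS : IsPForm n p S) :
    kq (Mpart hp (Pi.single z 1) (Pi.single a 1)) S
      = ∑ ρ, if ρ ⟨0, hp⟩ = z then S ρ * S (Function.update ρ ⟨0, hp⟩ a) else 0 := by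
  rw [kq_eq]
  refine Finset.sum_congr rfl fun ρ _ => ?_
  split_ifs with h0
  · rw [Finset.sum_eq_single (Function.update ρ ⟨0, hp⟩ a)]
    · by_cases h : S ρ = 0
      · simp [h]
      · have h1 := prod_erase_one hz (pform_inj hS h) _ h0
        rw [← Finset.mul_prod_erase _ _ (Finset.mem_univ (⟨0, hp⟩ : Fin p))]
        have h2 : ∏ x ∈ Finset.univ.erase (⟨0, hp⟩ : Fin p),
            Mpart hp (Pi.single z 1) (Pi.single a 1) x (ρ x) (Function.update ρ ⟨0, hp⟩ a x)
            = 1 := by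
          rw [← h1]
          refine Finset.prod_congr rfl fun i hi => ?_
          have hi' := Finset.ne_of_mem_erase hi
          simp [Mpart, hi', gM]
        rw [h2]
        simp [Mpart, Matrix.vecMulVec_apply, h0]
    · intro τ _ hτ
      obtain ⟨i, hi⟩ := Function.ne_iff.mp hτ
      rw [Finset.prod_eq_zero (Finset.mem_univ i), mul_zero]
      by_cases hi0 : i = ⟨0, hp⟩
      · subst hi0
        simp at hi
        simp [Mpart, Matrix.vecMulVec_apply, hi]
      · rw [Function.update_of_ne hi0] at hi
        simp [Mpart, hi0, gM, gmet, Ne.symm hi]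
    · simp
  · refine Finset.sum_eq_zero fun τ _ => ?_
    rw [Finset.prod_eq_zero (Finset.mem_univ (⟨0, hp⟩ : Fin p)), mul_zero]
    simp [Mpart, Matrix.vecMulVec_apply, h0]

lemma sq_perm {n p : ℕ} {S : (Fin p → Fin n) → ℝ} (hS : IsPForm n p S)
    (σ : Equiv.Perm (Fin p)) (μ : Fin p → Fin n) : S (μ ∘ σ) ^ 2 = S μ ^ 2 := by
  rw [hS]
  rcases Int.units_eq_one_or (Equiv.Perm.sign σ) with h | h <;> simp [h]

lemma mkp_single {n : ℕ} {z : Fin n} (hz : (z : ℕ) = 0) (x : Fin n → ℝ) :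
    mkp (Pi.single z 1) x = - x z := by
  rw [mkp, single_dotProduct]
  simp [Matrix.mulVec, dotProduct, gM, gmet, hz]

lemma TT00 {n p : ℕ} (hp : 0 < p) {z : Fin n} (hz : (z : ℕ) = 0)
    {S : (Fin p → Fin n) → ℝ} (hS : IsPForm n p S) :
    TT hp S (Pi.single z 1) (Pi.single z 1) = (∑ ρ, S ρ ^ 2) / (2 * (p.factorial : ℝ)) := by
  have hm := mkp_single hz (Pi.single z 1)
  unfold mkp at hm
  unfold TT
  rw [hm, kq_gM hz hS, kq_part hp hz z hS]
  have h1 := sum_cnt (fun ρ => S ρ ^ 2) (sq_perm hS) z ⟨0, hp⟩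
  have h2 : ∑ ρ, S ρ ^ 2 * (1 - 2 * cnt z ρ) = ∑ ρ, S ρ ^ 2 - 2 * ∑ ρ, S ρ ^ 2 * cnt z ρ := by
    rw [Finset.mul_sum, ← Finset.sum_sub_distrib]
    exact Finset.sum_congr rfl fun ρ _ => by ring
  have h3 : ∑ ρ : Fin p → Fin n,
      (if ρ ⟨0, hp⟩ = z then S ρ * S (Function.update ρ ⟨0, hp⟩ z) else 0)
      = ∑ ρ : Fin p → Fin n, (if ρ ⟨0, hp⟩ = z then S ρ ^ 2 else 0) := by
    refine Finset.sum_congr rfl fun ρ _ => ?_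
    split_ifs with h
    · rw [← h, Function.update_eq_self]; ring
    · rfl
  rw [h2, h1, h3]
  have hf : (p.factorial : ℝ) = p * ((p - 1).factorial : ℝ) := by
    exact_mod_cast (Nat.mul_factorial_pred hp.ne').symm
  have hp' : (p : ℝ) ≠ 0 := by exact_mod_cast hp.ne'
  have hq : ((p - 1).factorial : ℝ) ≠ 0 := by exact_mod_cast (Nat.factorial_ne_zero _)
  rw [hf]
  simp only [Pi.single_eq_same]
  field_simp
  ring

lemma part_bound {n p : ℕ} (hp : 0 < p) {z a : Fin n} (haz : a ≠ z)
    {S : (Fin p → Fin n) → ℝ} (hS : IsPForm n p S) :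
    |∑ ρ : Fin p → Fin n, if ρ ⟨0, hp⟩ = z then S ρ * S (Function.update ρ ⟨0, hp⟩ a) else 0|
      ≤ (∑ ρ, S ρ ^ 2) / (2 * p) := by
  classical
  set k0 : Fin p := ⟨0, hp⟩ with hk0
  have hp' : (0 : ℝ) < p := by exact_mod_cast hp
  let G : Fin n → (Fin p → Fin n) → ℝ := fun b ρ => if ∀ k, ρ k ≠ b then S ρ ^ 2 else 0
  have hG0 : ∀ b ρ, 0 ≤ G b ρ := by
    intro b ρ; simp only [G]; split_ifs <;> positivity
  have hGp : ∀ b (σ : Equiv.Perm (Fin p)) (μ : Fin p → Fin n), G b (μ ∘ σ) = G b μ := by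
    intro b σ μ
    simp only [G, sq_perm hS]
    have : (∀ k, (μ ∘ σ) k ≠ b) ↔ ∀ k, μ k ≠ b :=
      ⟨fun h k => by simpa using h (σ.symm k), fun h k => h (σ k)⟩
    simp only [this]
  have hz := sum_cnt (G a) (hGp a) z k0
  have ha := sum_cnt (G z) (hGp z) a k0
  have hre : ∑ ρ : Fin p → Fin n, (if ρ k0 = z then G z (Function.update ρ k0 a) else 0)
      = ∑ ρ : Fin p → Fin n, (if ρ k0 = a then G z ρ else 0) := by
    generalize G z = H
    rw [← Finset.sum_filter, ← Finset.sum_filter]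
    refine Finset.sum_nbij' (fun ρ => Function.update ρ k0 a) (fun ρ => Function.update ρ k0 z)
      ?_ ?_ ?_ ?_ ?_
    · intro ρ _; simp
    · intro ρ _; simp
    · intro ρ h
      have h : ρ k0 = z := by simpa using h
      simp [← h]
    · intro ρ h
      have h : ρ k0 = a := by simpa using h
      simp [← h]
    · intro ρ _; rfl
  have hle : ∑ ρ, G a ρ * cnt z ρ + ∑ ρ, G z ρ * cnt a ρ ≤ ∑ ρ, S ρ ^ 2 := by
    rw [← Finset.sum_add_distrib]
    refine Finset.sum_le_sum fun ρ _ => ?_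
    by_cases h : S ρ = 0
    · simp [G, h]
    have hi := pform_inj hS h
    by_cases h1 : ∃ k, ρ k = a
    · obtain ⟨k, hk⟩ := h1
      have e1 : G a ρ = 0 := if_neg fun h => h k hk
      have e2 : cnt a ρ = 1 := by rw [← hk, cnt_of_mem hi]
      rw [e1, e2]
      simp only [G]; split_ifs <;> nlinarith [sq_nonneg (S ρ)]
    · push Not at h1
      rw [cnt_of_not_mem h1]
      have e1 : G a ρ = S ρ ^ 2 := if_pos h1
      by_cases h2 : ∃ k, ρ k = z
      · obtain ⟨k, hk⟩ := h2
        have e2 : cnt z ρ = 1 := by rw [← hk, cnt_of_mem hi]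
        rw [e1, e2]; linarith
      · push Not at h2
        rw [cnt_of_not_mem h2]; nlinarith [sq_nonneg (S ρ)]
  rw [hz, ha, ← hre] at hle
  have hterm : ∀ ρ : Fin p → Fin n,
      |if ρ k0 = z then S ρ * S (Function.update ρ k0 a) else 0|
        ≤ ((if ρ k0 = z then G a ρ else 0)
          + (if ρ k0 = z then G z (Function.update ρ k0 a) else 0)) / 2 := by
    intro ρ
    split_ifs with h
    · by_cases h1 : S ρ = 0
      · rw [h1, zero_mul, abs_zero]
        have := hG0 a ρ
        have := hG0 z (Function.update ρ k0 a)
        linarith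
      by_cases h2 : S (Function.update ρ k0 a) = 0
      · rw [h2, mul_zero, abs_zero]
        have := hG0 a ρ
        have := hG0 z (Function.update ρ k0 a)
        linarith
      have i1 := pform_inj hS h1
      have i2 := pform_inj hS h2
      have e1 : G a ρ = S ρ ^ 2 := by
        refine if_pos fun k hk => ?_
        have hkk : k ≠ k0 := by
          rintro rfl; exact haz (hk.symm.trans h)
        apply hkk
        apply i2
        simp [Function.update_of_ne hkk, hk]
      have e2 : G z (Function.update ρ k0 a) = S (Function.update ρ k0 a) ^ 2 := by
        refine if_pos fun k hk => ?_
        by_cases hkk : k = k0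
        · rw [hkk] at hk
          simp at hk
          exact haz hk
        · rw [Function.update_of_ne hkk] at hk
          exact hkk (i1 (hk.trans h.symm))
      rw [e1, e2, abs_mul]
      nlinarith [sq_nonneg (|S ρ| - |S (Function.update ρ k0 a)|), sq_abs (S ρ),
        sq_abs (S (Function.update ρ k0 a))]
    · simp
  refine (Finset.abs_sum_le_sum_abs _ _).trans ((Finset.sum_le_sum fun ρ _ => hterm ρ).trans ?_)
  rw [← Finset.sum_div, Finset.sum_add_distrib, div_le_div_iff₀ (by norm_num) (by positivity)]
  nlinarith

lemma TT0a {n p : ℕ} (hp : 0 < p) {z a : Fin n} (hz : (z : ℕ) = 0) (haz : a ≠ z)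
    {S : (Fin p → Fin n) → ℝ} (hS : IsPForm n p S) :
    |TT hp S (Pi.single z 1) (Pi.single a 1)| ≤ (∑ ρ, S ρ ^ 2) / (2 * (p.factorial : ℝ)) := by
  have hm := mkp_single hz (Pi.single a 1)
  unfold mkp at hm
  unfold TT
  rw [hm, kq_part hp hz a hS, Pi.single_eq_of_ne haz.symm]
  have hf : (p.factorial : ℝ) = p * ((p - 1).factorial : ℝ) := by
    exact_mod_cast (Nat.mul_factorial_pred hp.ne').symm
  have hp' : (0 : ℝ) < p := by exact_mod_cast hp
  have hq : (0 : ℝ) < ((p - 1).factorial : ℝ) := by exact_mod_cast (Nat.factorial_pos _)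
  have hb := part_bound hp haz hS
  rw [neg_zero, mul_zero, zero_mul, sub_zero, abs_mul, abs_of_pos (by positivity), hf]
  calc _ ≤ 1 / ((p - 1).factorial : ℝ) * ((∑ ρ, S ρ ^ 2) / (2 * p)) := by gcongr
    _ = _ := by field_simp

lemma TT_lin {n p : ℕ} (hp : 0 < p) (S : (Fin p → Fin n) → ℝ) (u x y : Fin n → ℝ) (α β : ℝ) :
    TT hp S u (α • x + β • y) = α * TT hp S u x + β * TT hp S u y := by
  simp only [← seT_eq, Finset.mul_sum, ← Finset.sum_add_distrib, Pi.add_apply, Pi.smul_apply,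
    smul_eq_mul]
  exact Finset.sum_congr rfl fun i _ => Finset.sum_congr rfl fun j _ => by ring

lemma TT_swap_smul {n p : ℕ} (hp : 0 < p) (S : (Fin p → Fin n) → ℝ) (u x : Fin n → ℝ) (α : ℝ) :
    TT hp S (α • u) x = TT hp S u (α • x) := by
  simp only [← seT_eq, Pi.smul_apply, smul_eq_mul]
  exact Finset.sum_congr rfl fun i _ => Finset.sum_congr rfl fun j _ => by ring

lemma sumsq_pos {n p : ℕ} {S : (Fin p → Fin n) → ℝ} (h : S ≠ 0) : 0 < ∑ ρ, S ρ ^ 2 := by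
  obtain ⟨ρ, hρ⟩ := Function.ne_iff.mp h
  exact Finset.sum_pos' (fun _ _ => sq_nonneg _) ⟨ρ, Finset.mem_univ _, by
    have : S ρ ≠ 0 := hρ
    positivity⟩

lemma Pos_base {n p : ℕ} (hp : 0 < p) {z a : Fin n} (hz : (z : ℕ) = 0) (haz : a ≠ z)
    (α s : ℝ) (hs : |s| < α) :
    Pos (p := p) hp (Pi.single z 1) (α • (Pi.single z 1 : Fin n → ℝ) + s • Pi.single a 1) := by
  intro S hS h0
  rw [TT_lin, TT00 hp hz hS]
  have h1 := TT0a hp hz haz hS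
  have hN : 0 < (∑ ρ, S ρ ^ 2) / (2 * (p.factorial : ℝ)) :=
    div_pos (sumsq_pos h0) (by positivity)
  set N := (∑ ρ, S ρ ^ 2) / (2 * (p.factorial : ℝ))
  set t := TT hp S (Pi.single z 1) (Pi.single a 1)
  have h2 : |s * t| ≤ |s| * N := by rw [abs_mul]; gcongr
  have h3 := neg_abs_le (s * t)
  nlinarith

lemma Pos_base0 {n p : ℕ} (hp : 0 < p) {z : Fin n} (hz : (z : ℕ) = 0)
    (α : ℝ) (hs : 0 < α) :
    Pos (p := p) hp (Pi.single z 1) (α • (Pi.single z 1 : Fin n → ℝ)) := by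
  intro S hS h0
  have := TT_lin hp S (Pi.single z 1) (Pi.single z 1) 0 α 0
  rw [smul_zero, add_zero, zero_mul, add_zero] at this
  rw [this, TT00 hp hz hS]
  exact mul_pos hs (div_pos (sumsq_pos h0) (by positivity))

lemma mkp_eq {n : ℕ} {z : Fin n} (hz : (z : ℕ) = 0) (x y : Fin n → ℝ) :
    mkp x y = - (x z * y z) + ∑ i ∈ Finset.univ.erase z, x i * y i := by
  have : mkp x y = ∑ i, gmet n i i * (x i * y i) := by
    simp only [mkp, Matrix.mulVec, dotProduct, gM, Matrix.of_apply]
    refine Finset.sum_congr rfl fun i _ => ?_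
    rw [Finset.sum_eq_single i]
    · ring
    · intro j _ hj
      simp [gmet, Ne.symm hj]
    · simp
  rw [this, ← Finset.add_sum_erase _ _ (Finset.mem_univ z)]
  congr 1
  · simp [gmet, hz]
  · refine Finset.sum_congr rfl fun i hi => ?_
    rw [gmet_self hz (Finset.ne_of_mem_erase hi), one_mul]

lemma mkp_add_left {n : ℕ} (x y w : Fin n → ℝ) : mkp (x + y) w = mkp x w + mkp y w := by
  simp [mkp, add_dotProduct]
lemma mkp_smul_left {n : ℕ} (c : ℝ) (x w : Fin n → ℝ) : mkp (c • x) w = c * mkp x w := by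
  simp [mkp]
lemma mkp_comm {n : ℕ} (x w : Fin n → ℝ) : mkp x w = mkp w x := by
  unfold mkp
  rw [Matrix.dotProduct_mulVec, dotProduct_comm, ← Matrix.mulVec_transpose, gM_tr]
lemma mkp_sub_left {n : ℕ} (x y w : Fin n → ℝ) : mkp (x - y) w = mkp x w - mkp y w := by
  simp [mkp, sub_dotProduct]
lemma mkp_add_right {n : ℕ} (x y w : Fin n → ℝ) : mkp w (x + y) = mkp w x + mkp w y := by
  simp only [mkp_comm w, mkp_add_left]
lemma mkp_sub_right {n : ℕ} (x y w : Fin n → ℝ) : mkp w (x - y) = mkp w x - mkp w y := by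
  simp only [mkp_comm w, mkp_sub_left]
lemma mkp_smul_right {n : ℕ} (c : ℝ) (x w : Fin n → ℝ) : mkp w (c • x) = c * mkp w x := by
  simp only [mkp_comm w, mkp_smul_left]

lemma mkp_single' {n : ℕ} {a : Fin n} (ha : (a : ℕ) ≠ 0) (x : Fin n → ℝ) :
    mkp (Pi.single a 1) x = x a := by
  rw [mkp, single_dotProduct]
  simp [Matrix.mulVec, dotProduct, gM, gmet, ha]

lemma Pos_e0 {n p : ℕ} (hp : 0 < p) {z : Fin n} (hz : (z : ℕ) = 0) (w : Fin n → ℝ)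
    (hw : mkp w w < 0) (hw0 : 0 < w z) : Pos (p := p) hp (Pi.single z 1) w := by
  by_cases hex : ∃ a, a ≠ z ∧ w a ≠ 0
  · obtain ⟨a, haz, hwa⟩ := hex
    have ha0 : (a : ℕ) ≠ 0 := fun h => haz (Fin.ext (by omega))
    have hr : 0 < mkp w w + w z ^ 2 := by
      have : 0 < ∑ i ∈ Finset.univ.erase z, w i * w i :=
        Finset.sum_pos' (fun i _ => mul_self_nonneg _)
          ⟨a, Finset.mem_erase.2 ⟨haz, Finset.mem_univ _⟩, mul_self_pos.2 hwa⟩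
      rw [mkp_eq hz]; linarith
    obtain ⟨s, hs2, hsw⟩ : ∃ s : ℝ, s ^ 2 = mkp w w + w z ^ 2 ∧ s * w a ≤ 0 := by
      rcases le_total 0 (w a) with h | h
      · exact ⟨-√(mkp w w + w z ^ 2), by rw [neg_sq, Real.sq_sqrt hr.le],
          by nlinarith [Real.sqrt_nonneg (mkp w w + w z ^ 2)]⟩
      · exact ⟨√(mkp w w + w z ^ 2), Real.sq_sqrt hr.le,
          by nlinarith [Real.sqrt_nonneg (mkp w w + w z ^ 2)]⟩
    have hsl : |s| < w z := abs_lt_of_sq_lt_sq (by linarith) hw0.le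
    set v : Fin n → ℝ := w - w z • Pi.single z 1 - s • Pi.single a 1 with hv
    have hvw : mkp v w = s ^ 2 - s * w a := by
      simp only [hv, mkp_sub_left, mkp_smul_left, mkp_single hz, mkp_single' ha0]
      linarith
    have hvz : mkp v (Pi.single z 1) = 0 := by
      rw [mkp_comm, mkp_single hz]
      simp [hv, haz.symm]
    have hva : mkp v (Pi.single a 1) = w a - s := by
      rw [mkp_comm, mkp_single' ha0]
      simp [hv, haz]
    have hvv : mkp v v = 2 * (s ^ 2 - s * w a) := by
      conv_lhs => rw [hv, ← hv]
      have : mkp v v = mkp v w - w z * mkp v (Pi.single z 1) - s * mkp v (Pi.single a 1) := by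
        rw [← mkp_smul_right, ← mkp_smul_right, ← mkp_sub_right, ← mkp_sub_right]
      rw [this, hvw, hvz, hva]; ring
    have hne : s ^ 2 - s * w a ≠ 0 := by linarith
    refine Pos_refl hp _ _ v (by rw [hvv]; simpa using hne) ?_
    rw [hvz, hvw, hvv, div_self (by simpa using hne)]
    have : w - (1 : ℝ) • v = w z • (Pi.single z 1 : Fin n → ℝ) + s • Pi.single a 1 := by
      rw [hv]; module
    rw [this]
    simpa using Pos_base hp hz haz (w z) s hsl
  · push Not at hex
    have : w = w z • (Pi.single z 1 : Fin n → ℝ) := by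
      ext i
      by_cases hi : i = z
      · simp [hi]
      · simp [hi, hex i hi]
    rw [this]
    exact Pos_base0 hp hz _ hw0

lemma rev_cs {n : ℕ} {z : Fin n} (hz : (z : ℕ) = 0) (u w : Fin n → ℝ)
    (hu : mkp u u < 0) (hu0 : 0 < u z) (hw : mkp w w < 0) (hw0 : 0 < w z) : mkp u w < 0 := by
  rw [mkp_eq hz] at *
  have h := Finset.sum_mul_sq_le_sq_mul_sq (Finset.univ.erase z) u w
  have hu' : ∑ i ∈ Finset.univ.erase z, u i ^ 2 < u z ^ 2 := by
    simp only [pow_two]; linarith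
  have hw' : ∑ i ∈ Finset.univ.erase z, w i ^ 2 < w z ^ 2 := by
    simp only [pow_two]; linarith
  have hw'' : 0 ≤ ∑ i ∈ Finset.univ.erase z, w i ^ 2 := Finset.sum_nonneg fun i _ => sq_nonneg _
  have h2 : (∑ i ∈ Finset.univ.erase z, u i * w i) ^ 2 < (u z * w z) ^ 2 := by
    rw [mul_pow]
    refine h.trans_lt (mul_lt_mul'' hu' hw' (Finset.sum_nonneg fun i _ => sq_nonneg _) hw'')
  have := (abs_lt.1 (abs_lt_of_sq_lt_sq h2 (by positivity))).2
  linarith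

lemma Pos_all {n p : ℕ} (hp : 0 < p) {z : Fin n} (hz : (z : ℕ) = 0) (u w : Fin n → ℝ)
    (hu : mkp u u < 0) (hu0 : 0 < u z) (hw : mkp w w < 0) (hw0 : 0 < w z) :
    Pos (p := p) hp u w := by
  have huw := rev_cs hz u w hu hu0 hw hw0
  obtain ⟨κ, hκ, hκ2⟩ : ∃ κ : ℝ, 0 < κ ∧ κ ^ 2 = - mkp u u :=
    ⟨√(-mkp u u), Real.sqrt_pos.2 (by linarith), Real.sq_sqrt (by linarith)⟩
  set v : Fin n → ℝ := u + κ • Pi.single z 1 with hv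
  have hvx : ∀ x, mkp v x = mkp u x - κ * x z := by
    intro x
    rw [hv, mkp_add_left, mkp_smul_left, mkp_single hz]; ring
  have hvz : v z = u z + κ := by simp [hv]
  have hvu : mkp v u = - (κ * (κ + u z)) := by rw [hvx]; linarith
  have hvv : mkp v v = - (2 * (κ * (κ + u z))) := by
    rw [hvx v, mkp_comm, hvu, hvz]; ring
  have hpos : 0 < κ * (κ + u z) := by positivity
  have hne : mkp v v ≠ 0 := by rw [hvv]; linarith
  refine Pos_refl hp _ _ v hne ?_
  have e1 : 2 * mkp v u / mkp v v = 1 := by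
    rw [div_eq_one_iff_eq hne, hvu, hvv]; ring
  have e2 : u - (1 : ℝ) • v = (-κ) • (Pi.single z 1 : Fin n → ℝ) := by rw [hv]; module
  rw [e1, e2]
  set c := 2 * mkp v w / mkp v v with hc
  have hcv : c * mkp v v = 2 * mkp v w := by rw [hc]; field_simp
  intro S hS h0
  rw [TT_swap_smul]
  refine Pos_e0 hp hz _ ?_ ?_ S hS h0
  · have : mkp (w - c • v) (w - c • v) = mkp w w := by
      simp only [mkp_sub_left, mkp_sub_right, mkp_smul_left, mkp_smul_right, mkp_comm w v]
      linear_combination c * hcv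
    rw [mkp_smul_left, mkp_smul_right, this]
    nlinarith [mul_pos hκ hκ]
  · have : ((-κ) • (w - c • v)) z = - mkp u w := by
      simp only [Pi.smul_apply, Pi.sub_apply, smul_eq_mul, hvz]
      rw [hvv, hvx w] at hcv
      linear_combination (-1/2) * hcv
    rw [this]; linarith

/-- strict positivity of the super-energy tensor of a nonzero `p`-form
on pairs of future-pointing timelike vectors. -/
theorem seT_strictly_positive
    (n p : ℕ) (hp : 1 ≤ p) (hpn : p ≤ n)
    (S : (Fin p → Fin n) → ℝ) (hS : IsPForm n p S) (hS0 : S ≠ 0)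
    (u w : Fin n → ℝ)
    (hut : minkSq n u < 0) (huf : 0 < u ⟨0, by omega⟩)
    (hwt : minkSq n w < 0) (hwf : 0 < w ⟨0, by omega⟩) :
    0 < ∑ lam : Fin n, ∑ mu : Fin n, seT n p hp S lam mu * u lam * w mu := by
  rw [seT_eq]
  have hm : ∀ v, minkSq n v = mkp v v := by
    intro v
    simp only [minkSq, mkp, Matrix.mulVec, dotProduct, gM, Matrix.of_apply, Finset.mul_sum]
    exact Finset.sum_congr rfl fun i _ => Finset.sum_congr rfl fun j _ => by ring
  rw [hm] at hut hwt
  exact Pos_all hp rfl u w hut huf hwt hwf S hS hS0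
end
end

section
/- Let 1 ≤ p ≤ n, let Σ be a p-form on n-dimensional Minkowski space, let u be a unit timelike vector, set h^{μν} = η^{μν} + 2u^μu^ν, and let E_{ρ₂…ρ_p} = Σ_{ρ₁ρ₂…ρ_p} u^{ρ₁} be the electric part of Σ relative to u. Then Σ_{μ₁…μ_p} Σ_{ν₁…ν_p} h^{μ₁ν₁} ⋯ h^{μ_pν_p} = Σ_{ρ₁…ρ_p} Σ^{ρ₁…ρ_p} + 2p · E_{ρ₂…ρ_p} E^{ρ₂…ρ_p}. -/
open Finset

noncomputable section

/-- Components of the positive-definite metric `h^{μν} = η^{μν} + 2 u^μ u^ν`. -/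
def hInv (n : ℕ) (u : Fin n → ℝ) (μ ν : Fin n) : ℝ :=
  gmet n μ ν + 2 * u μ * u ν

/-- The contraction `E_{ρ₂…ρ_p} E^{ρ₂…ρ_p}` of the electric part
`E_{ρ₂…ρ_p} = Σ_{ρ₁ρ₂…ρ_p} u^{ρ₁}` of `Σ` relative to `u`. -/
def elecContract (n p : ℕ) (hp : 0 < p) (S : (Fin p → Fin n) → ℝ) (u : Fin n → ℝ) : ℝ :=
  ∑ ρ : Fin p → Fin n, ∑ τ : Fin p → Fin n,
    S ρ * S τ * u (ρ ⟨0, hp⟩) * u (τ ⟨0, hp⟩) *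
      ∏ i ∈ Finset.univ.filter (fun i => i ≠ (⟨0, hp⟩ : Fin p)), gmet n (ρ i) (τ i)

/-- The term of the expanded `h`-square in which the slots in `t` carry `2 u u`. -/
def hTerm (n p : ℕ) (S : (Fin p → Fin n) → ℝ) (u : Fin n → ℝ) (t : Finset (Fin p)) : ℝ :=
  ∑ μ : Fin p → Fin n, ∑ ν : Fin p → Fin n,
    S μ * S ν * ((∏ i ∈ t, 2 * u (μ i) * u (ν i)) * ∏ i ∈ Finset.univ \ t, gmet n (μ i) (ν i))

/-- Antisymmetry under a transposition. -/
theorem pform_swap {n p : ℕ} {S : (Fin p → Fin n) → ℝ} (hS : IsPForm n p S)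
    {i j : Fin p} (hij : i ≠ j) (μ : Fin p → Fin n) :
    S (μ ∘ Equiv.swap i j) = - S μ := by
  rw [hS, Equiv.Perm.sign_swap hij]; simp

theorem hTerm_zero {n p : ℕ} {S : (Fin p → Fin n) → ℝ} (hS : IsPForm n p S) (u : Fin n → ℝ)
    (t : Finset (Fin p)) {i j : Fin p} (hi : i ∈ t) (hj : j ∈ t) (hij : i ≠ j) :
    hTerm n p S u t = 0 := by
  have key : hTerm n p S u t = - hTerm n p S u t := by
    conv_lhs => unfold hTerm
    rw [← Equiv.sum_comp (Equiv.arrowCongr (Equiv.swap i j) (Equiv.refl (Fin n)))]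
    unfold hTerm
    rw [← Finset.sum_neg_distrib]
    refine Finset.sum_congr rfl fun μ _ => ?_
    rw [← Finset.sum_neg_distrib]
    refine Finset.sum_congr rfl fun ν _ => ?_
    have e : (Equiv.arrowCongr (Equiv.swap i j) (Equiv.refl (Fin n))) μ
        = μ ∘ Equiv.swap i j := by
      ext x; simp [Equiv.arrowCongr]
    rw [e, pform_swap hS hij]
    have h1 : ∏ k ∈ t, 2 * u ((μ ∘ Equiv.swap i j) k) * u (ν k)
        = ∏ k ∈ t, 2 * u (μ k) * u (ν k) := by
      simp only [Finset.prod_mul_distrib]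
      congr 2
      refine Finset.prod_equiv (Equiv.swap i j) (fun k => ?_) (fun k _ => rfl)
      by_cases hki : k = i
      · subst hki; simp [hi, hj]
      by_cases hkj : k = j
      · subst hkj; simp [hi, hj]
      rw [Equiv.swap_apply_of_ne_of_ne hki hkj]
    have h2 : ∏ k ∈ Finset.univ \ t, gmet n ((μ ∘ Equiv.swap i j) k) (ν k)
        = ∏ k ∈ Finset.univ \ t, gmet n (μ k) (ν k) := by
      refine Finset.prod_congr rfl fun k hk => ?_
      have hk' : k ∉ t := by simpa using hk
      have hki : k ≠ i := fun h => hk' (h ▸ hi)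
      have hkj : k ≠ j := fun h => hk' (h ▸ hj)
      rw [Function.comp_apply, Equiv.swap_apply_of_ne_of_ne hki hkj]
    rw [h1, h2]; ring
  linarith

theorem hTerm_single_eq {n p : ℕ} {S : (Fin p → Fin n) → ℝ} (hS : IsPForm n p S) (u : Fin n → ℝ)
    (i j : Fin p) : hTerm n p S u {i} = hTerm n p S u {j} := by
  by_cases hij : i = j
  · rw [hij]
  unfold hTerm
  have e : ∀ μ, (Equiv.arrowCongr (Equiv.swap i j) (Equiv.refl (Fin n))) μ
        = μ ∘ Equiv.swap i j := by
    intro μ; ext x; simp [Equiv.arrowCongr]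
  rw [← Equiv.sum_comp (Equiv.arrowCongr (Equiv.swap i j) (Equiv.refl (Fin n)))]
  refine Finset.sum_congr rfl fun μ _ => ?_
  rw [← Equiv.sum_comp (Equiv.arrowCongr (Equiv.swap i j) (Equiv.refl (Fin n)))]
  refine Finset.sum_congr rfl fun ν _ => ?_
  rw [e, e, pform_swap hS hij, pform_swap hS hij]
  have h2 : ∏ k ∈ Finset.univ \ {i}, gmet n ((μ ∘ Equiv.swap i j) k) ((ν ∘ Equiv.swap i j) k)
        = ∏ k ∈ Finset.univ \ {j}, gmet n (μ k) (ν k) := by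
    refine Finset.prod_equiv (Equiv.swap i j) (fun k => ?_) (fun k _ => rfl)
    simp [Equiv.swap_apply_eq_iff]
  rw [h2]; simp

theorem hTerm_single {n p : ℕ} (hp : 0 < p) {S : (Fin p → Fin n) → ℝ} (hS : IsPForm n p S)
    (u : Fin n → ℝ) (i : Fin p) : hTerm n p S u {i} = 2 * elecContract n p hp S u := by
  rw [hTerm_single_eq hS u i ⟨0, hp⟩]
  unfold hTerm elecContract
  rw [Finset.mul_sum]
  refine Finset.sum_congr rfl fun μ _ => ?_
  rw [Finset.mul_sum]
  refine Finset.sum_congr rfl fun ν _ => ?_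
  have : (Finset.univ \ {(⟨0, hp⟩ : Fin p)})
      = Finset.univ.filter (fun i => i ≠ (⟨0, hp⟩ : Fin p)) := by
    ext k; simp
  rw [this, Finset.prod_singleton]; ring

/-- the `h`-square of a `p`-form decomposes as
`Σ·Σ + 2p·E·E` where `E` is the electric part of `Σ` relative to `u`. -/
theorem hSquare_decomposition
    (n p : ℕ) (hp : 1 ≤ p) (hpn : p ≤ n)
    (S : (Fin p → Fin n) → ℝ) (hS : IsPForm n p S)
    (u : Fin n → ℝ) (hu : minkSq n u = -1) :
    (∑ μ : Fin p → Fin n, ∑ ν : Fin p → Fin n,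
        S μ * S ν * ∏ i : Fin p, hInv n u (μ i) (ν i))
      = fullContract n p S + 2 * (p : ℝ) * elecContract n p hp S u := by
  have h0 : (∑ μ : Fin p → Fin n, ∑ ν : Fin p → Fin n,
        S μ * S ν * ∏ i : Fin p, hInv n u (μ i) (ν i))
      = ∑ t : Finset (Fin p), hTerm n p S u t := by
    unfold hTerm
    rw [Finset.sum_comm]
    conv_rhs => rw [Finset.sum_comm]
    rw [Finset.sum_comm]
    refine Finset.sum_congr rfl fun μ _ => ?_
    rw [Finset.sum_comm]
    refine Finset.sum_congr rfl fun ν _ => ?_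
    rw [← Finset.mul_sum]
    congr 1
    rw [← Finset.powerset_univ, ← Finset.prod_add]
    refine Finset.prod_congr rfl fun i _ => ?_
    unfold hInv; ring
  have h1 : ∀ t : Finset (Fin p), hTerm n p S u t
      = (if t = ∅ then fullContract n p S else 0)
        + ∑ i : Fin p, if t = {i} then 2 * elecContract n p hp S u else 0 := by
    intro t
    by_cases ht : t = ∅
    · subst ht
      have : ∀ i : Fin p, (∅ : Finset (Fin p)) ≠ {i} := fun i =>
        (Finset.singleton_ne_empty i).symm
      simp [this, hTerm, fullContract]
    by_cases hc : ∃ i, t = {i}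
    · obtain ⟨i, rfl⟩ := hc
      rw [hTerm_single hp hS]
      simp
    · obtain ⟨i, hi⟩ := Finset.nonempty_iff_ne_empty.mpr ht
      have : ∃ j ∈ t, i ≠ j := by
        by_contra hcon
        push Not at hcon
        exact hc ⟨i, Finset.eq_singleton_iff_unique_mem.mpr ⟨hi, fun x hx => (hcon x hx).symm⟩⟩
      obtain ⟨j, hj, hij⟩ := this
      rw [hTerm_zero hS u t hi hj hij, if_neg ht, zero_add, Finset.sum_eq_zero]
      intro k _
      exact if_neg fun h => hc ⟨k, h⟩
  rw [h0, Finset.sum_congr rfl fun t _ => h1 t, Finset.sum_add_distrib, Finset.sum_comm]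
  simp
  ring
end
end
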